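/- arXiv:math/0312268 — 2 statements merged into one kernel-verified Lean document; each statement's English description precedes it below -/
import Mathlib

section
/- For n ≥ 5, the coefficient of symmetry of the symmetric Traveling Salesman Polytope ST_n with respect to its center c equals 2/(n−3); that is, 2/(n−3) is the largest α > 0 such that c − α(x − c) ∈ ST_n for all x ∈ ST_n. -/
/-- The set of adjacency matrices of Hamiltonian cycles on `n` vertices. -/
def hamiltonianCycleMatrices (n : ℕ) [NeZero n] : Set (Matrix (ZMod n) (ZMod n) ℝ) :=
  {M | ∃ σ : Equiv.Perm (ZMod n),
    ∀ i j, M i j = if σ i = σ j + 1 ∨ σ j = σ i + 1 then 1 else 0}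

/-- The symmetric Traveling Salesman Polytope. -/
def symmetricTSP (n : ℕ) [NeZero n] : Set (Matrix (ZMod n) (ZMod n) ℝ) :=
  convexHull ℝ (hamiltonianCycleMatrices n)

/-- The center of `ST_n`: the matrix with off-diagonal entries `2/(n-1)` and zero diagonal. -/
noncomputable def tspCenter (n : ℕ) : Matrix (ZMod n) (ZMod n) ℝ :=
  fun i j => if i = j then 0 else 2 / ((n : ℝ) - 1)

/-- The sum colouring of the edges of the complete graph on `ZMod N ∪ {∞}`: the edge `{i, j}` has
colour `i + j` and the edge `{∞, i}` has colour `2 * i`. -/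
def edgeColor {N : ℕ} : Option (ZMod N) → Option (ZMod N) → ZMod N
  | none, none => 0
  | none, some i => 2 * i
  | some i, none => 2 * i
  | some i, some j => i + j

lemma edgeColor_comm {N : ℕ} (x y : Option (ZMod N)) : edgeColor x y = edgeColor y x := by
  cases x <;> cases y <;> simp [edgeColor, add_comm]

/-- The zigzag `∞, 0, 1, -1, 2, -2, …` through `ZMod N ∪ {∞}`. -/
def zigzag (N p : ℕ) : Option (ZMod N) :=
  if p = 0 then none
  else if p % 2 = 0 then some (((p / 2 : ℕ) : ℤ) : ZMod N)
  else some ((-((p / 2 : ℕ) : ℤ) : ℤ) : ZMod N)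

lemma intCast_zmod_eq_iff_of_lt {N : ℕ} {a b : ℤ} (h₁ : -(N : ℤ) < b - a)
    (h₂ : b - a < 2 * N) : (a : ZMod N) = b ↔ b = a ∨ b = a + N := by
  rw [ZMod.intCast_eq_intCast_iff_dvd_sub]
  constructor
  · rintro ⟨k, hk⟩
    have hN : (0 : ℤ) < N := by omega
    have hk₁ : -1 < k := by nlinarith
    have hk₂ : k < 2 := by nlinarith
    interval_cases k <;> omega
  · rintro (h | h)
    · exact ⟨0, by omega⟩
    · exact ⟨1, by omega⟩

lemma zigzag_ne_of_lt {N p q : ℕ} (hpq : p < q) (hq : q ≤ N) :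
    zigzag N p ≠ zigzag N q := by
  unfold zigzag
  split_ifs with h1 h2 h3 h4 h5 h6 <;> try simp only [ne_eq, reduceCtorEq, not_false_eq_true,
    Option.some.injEq]
  all_goals first
    | omega
    | (rw [eq_comm, intCast_zmod_eq_iff_of_lt] <;> omega)

lemma edgeColor_zigzag_of_lt {N p q : ℕ} (hN : 4 ≤ N) (hpq : p < q) (hq : q ≤ N) :
    (edgeColor (zigzag N p) (zigzag N q) = 0 ∨ edgeColor (zigzag N p) (zigzag N q) = 1) ↔
      q = p + 1 ∨ (p = 0 ∧ q = N) := by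
  have key : ∀ a : ℤ, -(N : ℤ) < a → a ≤ N →
      (((a : ZMod N) = 0 ∨ (a : ZMod N) = 1) ↔ a = 0 ∨ a = 1 ∨ a = N ∨ a = 1 - N) := by
    intro a h1 h2
    have e0 : (a : ZMod N) = 0 ↔ a = 0 ∨ a = N := by
      have := intCast_zmod_eq_iff_of_lt (N := N) (a := 0) (b := a) (by omega) (by omega)
      rw [eq_comm]
      simpa using this
    have e1 : (a : ZMod N) = 1 ↔ 1 = a ∨ 1 = a + N := by
      have := intCast_zmod_eq_iff_of_lt (N := N) (a := a) (b := 1) (by omega) (by omega)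
      simpa using this
    rw [e0, e1]
    omega
  unfold zigzag
  split_ifs with h1 h2 h3 h4 h5 h6
  all_goals first
    | omega
    | (simp only [edgeColor]
       first
        | rw [← Int.cast_add, key _ (by omega) (by omega)]; omega
        | rw [← Int.cast_ofNat, ← Int.cast_mul, key _ (by omega) (by omega)]; omega)

/-- The zigzag as a bijection from `ZMod (N + 1)`. -/
noncomputable def zigzagEquiv (N : ℕ) [NeZero N] : ZMod (N + 1) ≃ Option (ZMod N) :=
  Equiv.ofBijective (fun x => zigzag N x.val) <| by
    rw [Fintype.bijective_iff_injective_and_card]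
    refine ⟨fun x y hxy => ?_, by simp [ZMod.card]⟩
    have hx := ZMod.val_lt x
    have hy := ZMod.val_lt y
    rcases lt_trichotomy x.val y.val with h | h | h
    · exact absurd hxy (zigzag_ne_of_lt h (by omega))
    · exact ZMod.val_injective _ h
    · exact absurd hxy.symm (zigzag_ne_of_lt h (by omega))

lemma zmod_eq_add_one_iff_val {N : ℕ} (x y : ZMod (N + 1)) :
    x = y + 1 ↔ x.val = y.val + 1 ∨ (x.val = 0 ∧ y.val = N) := by
  have hx := ZMod.val_lt x
  have hy := ZMod.val_lt y
  rw [← (ZMod.val_injective (N + 1)).eq_iff, ZMod.val_add, ZMod.val_one_eq_one_mod]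
  rw [Nat.add_mod_mod]
  rcases (by omega : y.val + 1 < N + 1 ∨ y.val = N) with h | h
  · rw [Nat.mod_eq_of_lt h]; omega
  · rw [h, Nat.mod_self]; omega

lemma edgeColor_zigzagEquiv {N : ℕ} [NeZero N] (hN : 4 ≤ N) (x y : ZMod (N + 1)) :
    (x = y + 1 ∨ y = x + 1) ↔
      x ≠ y ∧ (edgeColor (zigzagEquiv N x) (zigzagEquiv N y) = 0 ∨
        edgeColor (zigzagEquiv N x) (zigzagEquiv N y) = 1) := by
  have hx := ZMod.val_lt x
  have hy := ZMod.val_lt y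
  rw [zmod_eq_add_one_iff_val, zmod_eq_add_one_iff_val, ← (ZMod.val_injective (N + 1)).ne_iff]
  change _ ↔ _ ∧ (edgeColor (zigzag N x.val) (zigzag N y.val) = 0 ∨
    edgeColor (zigzag N x.val) (zigzag N y.val) = 1)
  rcases lt_trichotomy x.val y.val with h | h | h
  · rw [edgeColor_zigzag_of_lt hN h (by omega)]; omega
  · omega
  · rw [edgeColor_comm, edgeColor_zigzag_of_lt hN h (by omega)]; omega

lemma edgeColor_map_affine {N : ℕ} (u t : ZMod N) {x y : Option (ZMod N)} (hxy : x ≠ y) :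
    edgeColor (x.map (fun i => u * i + t)) (y.map (fun i => u * i + t)) =
      u * edgeColor x y + 2 * t := by
  cases x <;> cases y <;> simp_all [edgeColor] <;> ring

/-- The adjacency matrix of the colour class `c`, with vertices labelled through `τ`. -/
noncomputable def colorMatrix {V : Type*} {N : ℕ} (τ : V ≃ Option (ZMod N)) (c : ZMod N) :
    Matrix V V ℝ :=
  open Classical in fun i j => if i ≠ j ∧ edgeColor (τ i) (τ j) = c then 1 else 0

lemma colorMatrix_add_mem_hamiltonianCycleMatrices {N : ℕ} [NeZero N] [NeZero (N + 1)]
    (hN : 4 ≤ N) (τ : ZMod (N + 1) ≃ Option (ZMod N)) (t : ZMod N) (u : (ZMod N)ˣ) :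
    colorMatrix τ (2 * t) + colorMatrix τ (2 * t + u) ∈ hamiltonianCycleMatrices (N + 1) := by
  let A : Option (ZMod N) ≃ Option (ZMod N) :=
    Equiv.optionCongr ((Units.mulLeft u).trans (Equiv.addRight t))
  have hA : ∀ x, A x = x.map (fun i => (u : ZMod N) * i + t) := by
    intro x; cases x <;> simp [A]
  have : Fact (1 < N) := ⟨by omega⟩
  refine ⟨(τ.trans A.symm).trans (zigzagEquiv N).symm, fun i j => ?_⟩
  have h := edgeColor_zigzagEquiv hN ((zigzagEquiv N).symm (A.symm (τ i)))
    ((zigzagEquiv N).symm (A.symm (τ j)))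
  simp only [Equiv.apply_symm_apply, ne_eq, EmbeddingLike.apply_eq_iff_eq] at h
  simp only [Equiv.trans_apply, h, Matrix.add_apply, colorMatrix]
  by_cases hij : i = j
  · simp [hij]
  have hc : edgeColor (τ i) (τ j) = u * edgeColor (A.symm (τ i)) (A.symm (τ j)) + 2 * t := by
    rw [← edgeColor_map_affine _ _ (by simpa using hij), ← hA, ← hA]
    simp
  have h0 : edgeColor (τ i) (τ j) = 2 * t ↔ edgeColor (A.symm (τ i)) (A.symm (τ j)) = 0 := by
    rw [hc]; simp
  have h1 : edgeColor (τ i) (τ j) = 2 * t + u ↔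
      edgeColor (A.symm (τ i)) (A.symm (τ j)) = 1 := by
    rw [hc, add_comm, add_right_inj]
    exact ⟨fun e => u.mul_right_inj.1 (by rw [e, mul_one]), fun e => by rw [e, mul_one]⟩
  simp only [h0, h1, hij]
  by_cases k0 : edgeColor (A.symm (τ i)) (A.symm (τ j)) = 0
  · simp [k0, hij]
  · simp [k0, hij]

lemma sum_colorMatrix_apply {V : Type*} {N : ℕ} (hN : 2 ≤ N) (τ : V ≃ Option (ZMod N))
    (i j : V) :
    (∑ c ∈ Finset.range (N - 2), colorMatrix τ ((c + 2 : ℕ) : ZMod N)) i j =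
      open Classical in
      if i ≠ j ∧ ¬(edgeColor (τ i) (τ j) = 0 ∨ edgeColor (τ i) (τ j) = 1) then 1 else 0 := by
  have : NeZero N := ⟨by omega⟩
  rw [Matrix.sum_apply]
  simp only [colorMatrix]
  by_cases hij : i = j
  · simp [hij]
  simp only [ne_eq, hij, not_false_eq_true, true_and]
  generalize edgeColor (τ i) (τ j) = s
  have hs := ZMod.val_lt s
  have hcast : ∀ c < N, s = ((c : ℕ) : ZMod N) ↔ s.val = c := by
    intro c hc
    rw [← (ZMod.val_injective N).eq_iff, ZMod.val_cast_of_lt hc]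
  have h0 := hcast 0 (by omega)
  have h1 := hcast 1 (by omega)
  rw [Nat.cast_zero] at h0
  rw [Nat.cast_one] at h1
  simp only [h0, h1]
  have hsum : ∀ c ∈ Finset.range (N - 2),
      (if s = ((c + 2 : ℕ) : ZMod N) then (1 : ℝ) else 0) = if s.val = c + 2 then 1 else 0 := by
    intro c hc
    rw [Finset.mem_range] at hc
    simp only [hcast (c + 2) (by omega)]
  rw [Finset.sum_congr rfl hsum]
  by_cases h : s.val = 0 ∨ s.val = 1
  · rw [if_neg (not_not.2 h)]
    refine Finset.sum_eq_zero fun c _ => ?_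
    rw [if_neg (by omega)]
  · rw [if_pos h, Finset.sum_eq_single (s.val - 2)]
    · rw [if_pos (by omega)]
    · intro b _ hb
      rw [if_neg (by omega)]
    · intro hb
      rw [Finset.mem_range] at hb
      omega

lemma Convex.inv_smul_sum_range_mem {E : Type*} [AddCommGroup E] [Module ℝ E] {S : Set E}
    (hS : Convex ℝ S) {k : ℕ} (hk : k ≠ 0) {z : ℕ → E} (hz : ∀ i < k, z i ∈ S) :
    (k : ℝ)⁻¹ • ∑ i ∈ Finset.range k, z i ∈ S := by
  rw [Finset.smul_sum]
  refine hS.sum_mem (fun _ _ => by positivity) ?_ fun i hi => hz i (Finset.mem_range.1 hi)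
  simp [hk]

lemma sum_range_consecutive_pairs {E : Type*} [AddCommMonoid E] (g : ℕ → E) (k : ℕ) :
    ∑ i ∈ Finset.range k, (g (2 * i) + g (2 * i + 1)) = ∑ c ∈ Finset.range (2 * k), g c := by
  induction k with
  | zero => simp
  | succ k ih =>
    rw [Finset.sum_range_succ, ih, Nat.mul_succ, Finset.sum_range_succ, Finset.sum_range_succ,
      add_assoc]

lemma Convex.smul_sum_range_mem_of_pairs {E : Type*} [AddCommGroup E] [Module ℝ E] {S : Set E}
    (hS : Convex ℝ S) (g : ℕ → E) (r : ℕ) (h₁ : ∀ i ≤ r, g i + g (i + 1) ∈ S)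
    (h₂ : ∀ i < r, g i + g (i + 2) ∈ S) :
    (2 / ((r + 2 : ℕ) : ℝ)) • ∑ c ∈ Finset.range (r + 2), g c ∈ S := by
  let z : ℕ → E := fun i =>
    if i = 0 then g 0 + g 1 else if i = r + 1 then g r + g (r + 1) else g (i - 1) + g (i + 1)
  have hz : ∀ i < r + 2, z i ∈ S := by
    intro i hi
    simp only [z]
    split_ifs with h h'
    · exact h₁ 0 (by omega)
    · exact h₁ r le_rfl
    · obtain ⟨i, rfl⟩ := Nat.exists_eq_succ_of_ne_zero h
      exact h₂ i (by omega)
  have hsum : ∑ i ∈ Finset.range (r + 2), z i =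
      (2 : ℝ) • ∑ c ∈ Finset.range (r + 2), g c := by
    have hmid : ∑ i ∈ Finset.range r, z (i + 1) = ∑ i ∈ Finset.range r, (g i + g (i + 2)) := by
      refine Finset.sum_congr rfl fun i hi => ?_
      rw [Finset.mem_range] at hi
      simp [z, hi.ne]
    have hshift : ∑ i ∈ Finset.range r, g (i + 2) + g 1 + g 0 =
        ∑ i ∈ Finset.range (r + 2), g i := by
      rw [Finset.sum_range_succ', Finset.sum_range_succ']
    have hz0 : z 0 = g 0 + g 1 := by simp [z]
    have hzr : z (r + 1) = g r + g (r + 1) := by simp [z]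
    rw [Finset.sum_range_succ', Finset.sum_range_succ, hmid, hz0, hzr, Finset.sum_add_distrib,
      two_smul]
    nth_rw 1 [← hshift]
    rw [Finset.sum_range_succ, Finset.sum_range_succ]
    abel
  have := hS.inv_smul_sum_range_mem (by omega) hz
  rwa [hsum, smul_smul, inv_mul_eq_div] at this

lemma smul_sum_colorMatrix_mem_symmetricTSP {N : ℕ} [NeZero N] [NeZero (N + 1)] (hN : 4 ≤ N)
    (τ : ZMod (N + 1) ≃ Option (ZMod N)) :
    (2 / ((N : ℝ) - 2)) • ∑ c ∈ Finset.range (N - 2), colorMatrix τ ((c + 2 : ℕ) : ZMod N) ∈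
      symmetricTSP (N + 1) := by
  have hS : Convex ℝ (symmetricTSP (N + 1)) := convex_convexHull ℝ _
  have hmem : ∀ (t : ZMod N) (u : (ZMod N)ˣ) (a b : ℕ), (a : ZMod N) = 2 * t →
      (b : ZMod N) = 2 * t + u →
      colorMatrix τ (a : ZMod N) + colorMatrix τ (b : ZMod N) ∈ symmetricTSP (N + 1) := by
    intro t u a b ha hb
    rw [ha, hb]
    exact subset_convexHull ℝ _ (colorMatrix_add_mem_hamiltonianCycleMatrices hN τ t u)
  rcases Nat.even_or_odd N with hev | hodd
  · obtain ⟨k, rfl⟩ : ∃ k, N = 2 * (k + 1) := by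
      obtain ⟨k, hk⟩ := hev
      exact ⟨k - 1, by omega⟩
    have hk : k ≠ 0 := by omega
    have h := hS.inv_smul_sum_range_mem hk
      (z := fun i => colorMatrix τ ((2 * i + 2 : ℕ) : ZMod (2 * (k + 1))) +
        colorMatrix τ ((2 * i + 1 + 2 : ℕ) : ZMod (2 * (k + 1))))
      (fun i _ => hmem (i + 1) 1 _ _ (by push_cast; ring) (by push_cast; ring))
    rw [sum_range_consecutive_pairs
      (fun c => colorMatrix τ ((c + 2 : ℕ) : ZMod (2 * (k + 1))))] at h
    have hcoef : 2 / (((2 * (k + 1) : ℕ) : ℝ) - 2) = (k : ℝ)⁻¹ := by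
      have : (k : ℝ) ≠ 0 := by exact_mod_cast hk
      push_cast
      rw [show 2 * ((k : ℝ) + 1) - 2 = 2 * k by ring]
      field_simp
    rw [hcoef]
    exact h
  · obtain ⟨r, rfl⟩ : ∃ r, N = r + 4 := ⟨N - 4, by omega⟩
    have h2 : IsUnit (2 : ZMod (r + 4)) := by
      have := (ZMod.isUnit_iff_coprime 2 (r + 4)).2 (Nat.coprime_two_left.2 hodd)
      exact_mod_cast this
    obtain ⟨w, hw⟩ := h2
    have hhalf : ∀ a : ZMod (r + 4), 2 * ((w⁻¹ : (ZMod (r + 4))ˣ) * a) = a := by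
      intro a
      rw [← hw, Units.mul_inv_cancel_left]
    have h := hS.smul_sum_range_mem_of_pairs
      (fun c => colorMatrix τ ((c + 2 : ℕ) : ZMod (r + 4))) r
      (fun i _ => hmem _ 1 _ _ (hhalf _).symm (by rw [hhalf]; push_cast; ring))
      (fun i _ => hmem _ w _ _ (hhalf _).symm (by rw [hhalf, hw]; push_cast; ring))
    have hcoef : ((r + 4 : ℕ) : ℝ) - 2 = ((r + 2 : ℕ) : ℝ) := by push_cast; ring
    rw [hcoef]
    exact h

lemma symmetricTSP_apply_nonneg {n : ℕ} [NeZero n] {x : Matrix (ZMod n) (ZMod n) ℝ}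
    (hx : x ∈ symmetricTSP n) (i j : ZMod n) : 0 ≤ x i j := by
  have hsub : symmetricTSP n ⊆ {M | 0 ≤ M i j} := by
    refine convexHull_min ?_ ?_
    · rintro M ⟨σ, hσ⟩
      rw [Set.mem_ofPred_eq, hσ]
      split_ifs <;> norm_num
    · intro M hM M' hM' a b ha hb _
      simp only [Set.mem_ofPred_eq, Matrix.add_apply, Matrix.smul_apply, smul_eq_mul] at *
      positivity
  exact hsub hx

lemma tspCenter_sub_smul_mem_of_hamiltonianCycle {N : ℕ} [NeZero N] [NeZero (N + 1)]
    (hN : 4 ≤ N) {M : Matrix (ZMod (N + 1)) (ZMod (N + 1)) ℝ}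
    (hM : M ∈ hamiltonianCycleMatrices (N + 1)) :
    tspCenter (N + 1) - (2 / ((N : ℝ) - 2)) • (M - tspCenter (N + 1)) ∈
      symmetricTSP (N + 1) := by
  obtain ⟨σ, hσ⟩ := hM
  convert smul_sum_colorMatrix_mem_symmetricTSP hN (σ.trans (zigzagEquiv N)) using 1
  ext i j
  have hN' : (4 : ℝ) ≤ N := by exact_mod_cast hN
  have h2 : (N : ℝ) - 2 ≠ 0 := by linarith
  have h0 : (N : ℝ) ≠ 0 := by linarith
  rw [Matrix.smul_apply, sum_colorMatrix_apply (by omega)]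
  simp only [Matrix.sub_apply, Matrix.smul_apply, hσ, smul_eq_mul, tspCenter,
    edgeColor_zigzagEquiv hN, Equiv.trans_apply, ne_eq, EmbeddingLike.apply_eq_iff_eq]
  by_cases hij : i = j
  · simp [hij]
  push_cast
  simp only [hij, not_false_eq_true, true_and, if_false, add_sub_cancel_right]
  split_ifs with h <;> field_simp <;> ring

/-- For `n ≥ 5`, the coefficient of symmetry of `ST_n` with respect to its
center `c` equals `2/(n-3)`: it is the greatest `α > 0` such that `c - α (x - c) ∈ ST_n`
for every `x ∈ ST_n`. -/
theorem symmetryCoefficient_symmetricTSP (n : ℕ) [NeZero n] (hn : 5 ≤ n) :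
    IsGreatest {α : ℝ | 0 < α ∧
        ∀ x ∈ symmetricTSP n, tspCenter n - α • (x - tspCenter n) ∈ symmetricTSP n}
      (2 / ((n : ℝ) - 3)) := by
  obtain ⟨N, rfl⟩ : ∃ N, n = N + 1 := ⟨n - 1, by omega⟩
  have hN : 4 ≤ N := by omega
  have : NeZero N := ⟨by omega⟩
  have hN' : (4 : ℝ) ≤ N := by exact_mod_cast hN
  have hcast : ((N + 1 : ℕ) : ℝ) - 3 = N - 2 := by push_cast; ring
  rw [hcast]
  refine ⟨⟨div_pos two_pos (by linarith), fun x hx => ?_⟩, fun α hα => ?_⟩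
  · have hsub : symmetricTSP (N + 1) ⊆ {x | tspCenter (N + 1) -
        (2 / ((N : ℝ) - 2)) • (x - tspCenter (N + 1)) ∈ symmetricTSP (N + 1)} := by
      refine convexHull_min (fun M hM => tspCenter_sub_smul_mem_of_hamiltonianCycle hN hM) ?_
      intro x hx y hy a b ha hb hab
      have := (convex_convexHull ℝ (hamiltonianCycleMatrices (N + 1))) hx hy ha hb hab
      rw [Set.mem_ofPred_eq]
      obtain rfl : b = 1 - a := by linarith
      have haff : ∀ (c : Matrix (ZMod (N + 1)) (ZMod (N + 1)) ℝ) (α : ℝ),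
          c - α • (a • x + (1 - a) • y - c) =
            a • (c - α • (x - c)) + (1 - a) • (c - α • (y - c)) := by
        intro c α
        module
      rwa [haff]
    exact hsub hx
  · obtain ⟨-, hα⟩ := hα
    have : Fact (1 < N + 1) := ⟨by omega⟩
    let M : Matrix (ZMod (N + 1)) (ZMod (N + 1)) ℝ := fun i j =>
      if i = j + 1 ∨ j = i + 1 then 1 else 0
    have hM : M ∈ symmetricTSP (N + 1) :=
      subset_convexHull ℝ _ ⟨Equiv.refl _, fun i j => rfl⟩
    have h := symmetricTSP_apply_nonneg (hα M hM) 0 1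
    have hM01 : M 0 1 = 1 := by simp [M]
    simp only [Matrix.sub_apply, Matrix.smul_apply, smul_eq_mul, hM01, tspCenter, zero_ne_one,
      if_false] at h
    push_cast at h
    rw [add_sub_cancel_right] at h
    rw [le_div_iff₀ (by linarith)]
    have hmul : 0 ≤ (2 / (N : ℝ) - α * (1 - 2 / N)) * N := mul_nonneg h (by linarith)
    have heq : (2 / (N : ℝ) - α * (1 - 2 / N)) * N = 2 - α * (N - 2) := by
      field_simp
    linarith
end

section
/- Let d = dim U_{2k,n} = binom(n+2k−1, 2k) − 1, let K be the unit L²-ball in U_{2k,n}, and let Pos'_{2k,n} = {p ∈ U_{2k,n} : p(x) ≥ −1 for all x ∈ S^{n−1}}. If I denotes the average over the unit sphere Σ of U_{2k,n} of max_{x∈S^{n−1}}|p(x)|, then (vol Pos'_{2k,n} / vol K)^{1/d} ≥ 1/I; i.e., (vol Pos'_{2k,n}/vol K)^{1/d} ≥ (∫_Σ ‖p‖_∞ dp)^{−1}. -/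
open MeasureTheory

/-- The map induced on the unit sphere by a linear isometry (a "rotation"). -/
def sphereRot {E : Type*} [NormedAddCommGroup E] [InnerProductSpace ℝ E]
    (g : E ≃ₗᵢ[ℝ] E) (x : Metric.sphere (0 : E) 1) : Metric.sphere (0 : E) 1 :=
  ⟨g x, by
    have hx : ‖(x : E)‖ = 1 := by
      simpa only [Metric.mem_sphere, dist_zero_right] using x.2
    simp only [Metric.mem_sphere, dist_zero_right, g.norm_map]
    exact hx⟩

/-- Evaluation of a polynomial at a point of the unit sphere of `ℝⁿ`. -/
noncomputable def sphereEval {n : ℕ} (f : MvPolynomial (Fin n) ℝ)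
    (x : Metric.sphere (0 : EuclideanSpace ℝ (Fin n)) 1) : ℝ :=
  MvPolynomial.eval (fun i => (x : EuclideanSpace ℝ (Fin n)) i) f

open scoped RealInnerProductSpace

/-- Two probability measures on a compact metric space for which the measure of a ball depends only
on its radius agree. -/
theorem eq_of_measure_ball_eq {X : Type*} [MetricSpace X] [CompactSpace X] [MeasurableSpace X]
    [BorelSpace X] (μ ν : Measure X) [IsProbabilityMeasure μ] [IsProbabilityMeasure ν]
    (hμ : ∀ x y r, μ (Metric.ball x r) = μ (Metric.ball y r))
    (hν : ∀ x y r, ν (Metric.ball x r) = ν (Metric.ball y r)) : μ = ν := by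
  obtain ⟨x₀⟩ : Nonempty X := nonempty_of_isProbabilityMeasure μ
  refine ext_of_forall_integral_eq_of_IsFiniteMeasure fun f => ?_
  have hf : ∀ ρ : Measure X, IsProbabilityMeasure ρ → Integrable f ρ := fun ρ _ => f.integrable ρ
  refine eq_of_forall_dist_le fun η hη => ?_
  obtain ⟨ε, hε, hfε⟩ := Metric.uniformContinuous_iff.1
    (CompactSpace.uniformContinuous_of_continuous f.continuous) η hη
  set A : Set (X × X) := {p | dist p.1 p.2 < ε} with hA
  have hAm : MeasurableSet A := (isOpen_lt (by fun_prop) continuous_const).measurableSet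
  have hf1 : Integrable (fun p : X × X => f p.1) (μ.prod ν) := (hf μ inferInstance).comp_fst ν
  have hf2 : Integrable (fun p : X × X => f p.2) (μ.prod ν) := (hf ν inferInstance).comp_snd μ
  have key1 : ∀ g : X → ℝ, Integrable (fun p : X × X => g p.1) (μ.prod ν) →
      ∫ p in A, g p.1 ∂(μ.prod ν) = ν.real (Metric.ball x₀ ε) * ∫ x, g x ∂μ := by
    intro g hg
    rw [← integral_indicator hAm, integral_prod _ (hg.indicator hAm), ← integral_const_mul]
    congr 1 with x
    have : (fun y => A.indicator (fun p : X × X => g p.1) (x, y))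
        = (Metric.ball x ε).indicator (fun _ => g x) := by
      ext y
      simp [Set.indicator, hA, dist_comm]
    rw [this, integral_indicator Metric.isOpen_ball.measurableSet, setIntegral_const, smul_eq_mul,
      measureReal_def, measureReal_def, hν x x₀]
  have key2 : ∀ g : X → ℝ, Integrable (fun p : X × X => g p.2) (μ.prod ν) →
      ∫ p in A, g p.2 ∂(μ.prod ν) = μ.real (Metric.ball x₀ ε) * ∫ x, g x ∂ν := by
    intro g hg
    rw [← integral_indicator hAm, integral_prod_symm _ (hg.indicator hAm), ← integral_const_mul]
    congr 1 with y
    have : (fun x => A.indicator (fun p : X × X => g p.2) (x, y))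
        = (Metric.ball y ε).indicator (fun _ => g y) := by
      ext x
      simp [Set.indicator, hA]
    rw [this, integral_indicator Metric.isOpen_ball.measurableSet, setIntegral_const, smul_eq_mul,
      measureReal_def, measureReal_def, hμ y x₀]
  have hc1 := key1 (fun _ => 1) (integrable_const _)
  have hc2 := key2 (fun _ => 1) (integrable_const _)
  have hν1 : (μ.prod ν).real A = ν.real (Metric.ball x₀ ε) := by simpa using hc1
  have hμ1 : (μ.prod ν).real A = μ.real (Metric.ball x₀ ε) := by simpa using hc2
  have hpos : 0 < μ.real (Metric.ball x₀ ε) := by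
    refine ENNReal.toReal_pos (fun h0 => ?_) (measure_ne_top _ _)
    refine IsProbabilityMeasure.ne_zero μ (Measure.measure_univ_eq_zero.1 ?_)
    refine measure_null_of_locally_null _ fun x _ => ⟨Metric.ball x ε, ?_, (hμ x x₀ ε).trans h0⟩
    exact mem_nhdsWithin_of_mem_nhds (Metric.ball_mem_nhds x hε)
  have hle : ‖∫ p in A, (f p.1 - f p.2) ∂(μ.prod ν)‖ ≤ η * (μ.prod ν).real A := by
    refine norm_setIntegral_le_of_norm_le_const (measure_lt_top _ _) fun p hp => ?_
    simpa [Real.dist_eq] using (hfε hp).le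
  rw [integral_sub hf1.integrableOn hf2.integrableOn, key1 f hf1, key2 f hf2, ← hν1, hμ1,
    ← mul_sub, norm_mul, Real.norm_of_nonneg hpos.le, mul_comm] at hle
  exact le_of_mul_le_mul_right hle hpos

section Sphere

open scoped Pointwise

variable {E : Type*} [NormedAddCommGroup E] [InnerProductSpace ℝ E]

theorem sphereRot_preimage_ball (g : E ≃ₗᵢ[ℝ] E) (x : Metric.sphere (0 : E) 1) (r : ℝ) :
    sphereRot g ⁻¹' Metric.ball (sphereRot g x) r = Metric.ball x r := by
  ext y
  simp [sphereRot, Subtype.dist_eq]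

theorem exists_sphereRot_eq (x y : Metric.sphere (0 : E) 1) :
    ∃ g : E ≃ₗᵢ[ℝ] E, sphereRot g x = y :=
  ⟨(ℝ ∙ ((x : E) - y))ᗮ.reflection, Subtype.ext (Submodule.reflection_sub (by simp))⟩

variable [MeasurableSpace E] [BorelSpace E]

theorem measure_ball_eq_of_measurePreserving_sphereRot (μ : Measure (Metric.sphere (0 : E) 1))
    (hμ : ∀ g : E ≃ₗᵢ[ℝ] E, MeasurePreserving (sphereRot g) μ μ)
    (x y : Metric.sphere (0 : E) 1) (r : ℝ) :
    μ (Metric.ball x r) = μ (Metric.ball y r) := by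
  obtain ⟨g, rfl⟩ := exists_sphereRot_eq x y
  rw [← sphereRot_preimage_ball g x r,
    (hμ g).measure_preimage Metric.isOpen_ball.measurableSet.nullMeasurableSet]

theorem measurePreserving_sphereRot_toSphere [FiniteDimensional ℝ E] (g : E ≃ₗᵢ[ℝ] E) :
    MeasurePreserving (sphereRot g) (volume : Measure E).toSphere
      (volume : Measure E).toSphere := by
  have hm : Measurable (sphereRot g) :=
    (g.continuous.measurable.comp measurable_subtype_coe).subtype_mk
  refine ⟨hm, Measure.ext fun s hs => ?_⟩
  rw [Measure.map_apply hm hs, Measure.toSphere_apply' _ (hm hs), Measure.toSphere_apply' _ hs,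
    ← g.measurePreserving.measure_preimage_equiv (f := g.toMeasurableEquiv)
      (Set.Ioo (0 : ℝ) 1 • (Subtype.val '' s))]
  congr 2
  ext z
  simp only [Set.mem_smul, Set.mem_image, Set.mem_preimage]
  constructor
  · rintro ⟨a, ha, _, ⟨y, hy, rfl⟩, rfl⟩
    exact ⟨a, ha, _, ⟨_, hy, rfl⟩, by simp [sphereRot]⟩
  · rintro ⟨a, ha, _, ⟨y, hy, rfl⟩, hz⟩
    refine ⟨a, ha, _, ⟨sphereRot g.symm y, ?_, rfl⟩, ?_⟩
    · convert hy
      ext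
      simp [sphereRot]
    · apply g.injective
      simpa [sphereRot] using hz

/-- The normalized surface measure is the only rotation-invariant probability measure on the unit
sphere. -/
theorem toSphere_eq_smul [FiniteDimensional ℝ E] (μ : Measure (Metric.sphere (0 : E) 1))
    [IsProbabilityMeasure μ] (hμ : ∀ g : E ≃ₗᵢ[ℝ] E, MeasurePreserving (sphereRot g) μ μ) :
    (volume : Measure E).toSphere =
      (Module.finrank ℝ E * volume (Metric.ball (0 : E) 1)) • μ := by
  obtain ⟨x⟩ : Nonempty (Metric.sphere (0 : E) 1) := nonempty_of_isProbabilityMeasure μ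
  have : Nontrivial E := ⟨⟨x, 0, ne_of_apply_ne Norm.norm (by simp)⟩⟩
  set c := (volume : Measure E).toSphere Set.univ with hc
  have hc0 : c ≠ 0 := Measure.measure_univ_ne_zero.2 (Measure.toSphere_ne_zero _)
  have hct : c ≠ ⊤ := measure_ne_top _ _
  have hp : IsProbabilityMeasure (c⁻¹ • (volume : Measure E).toSphere) :=
    ⟨by simp only [Measure.smul_apply, smul_eq_mul]; exact ENNReal.inv_mul_cancel hc0 hct⟩
  have h : c⁻¹ • (volume : Measure E).toSphere = μ :=
    eq_of_measure_ball_eq _ _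
      (measure_ball_eq_of_measurePreserving_sphereRot _
        fun g => (measurePreserving_sphereRot_toSphere g).smul_measure _)
      (measure_ball_eq_of_measurePreserving_sphereRot _ hμ)
  rw [← Measure.toSphere_apply_univ, ← hc, ← h, smul_smul, ENNReal.mul_inv_cancel hc0 hct,
    one_smul]

/-- Polar-coordinate formula for the volume of the open unit ball of a gauge. -/
theorem volume_lt_one_eq_lintegral_toSphere [FiniteDimensional ℝ E] [Nontrivial E] (N : E → ℝ)
    (hNc : Continuous N) (hNs : ∀ t : ℝ, 0 < t → ∀ x, N (t • x) = t * N x)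
    (hN : ∀ x, x ≠ 0 → 0 < N x) :
    volume {x : E | N x < 1} = ∫⁻ x : Metric.sphere (0 : E) 1,
      ENNReal.ofReal ((N x ^ Module.finrank ℝ E)⁻¹ / Module.finrank ℝ E)
        ∂(volume : Measure E).toSphere := by
  have hd : 0 < Module.finrank ℝ E := Module.finrank_pos
  set B : Set (Metric.sphere (0 : E) 1 × Set.Ioi (0 : ℝ)) := {p | p.2.1 * N p.1 < 1} with hB
  have hBm : MeasurableSet B :=
    (isOpen_lt (by fun_prop) continuous_const).measurableSet
  have hmp := (volume : Measure E).measurePreserving_homeomorphUnitSphereProd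
  have h1 : homeomorphUnitSphereProd E ⁻¹' B = Subtype.val ⁻¹' {x : E | N x < 1} := by
    ext x
    have hx : 0 < ‖x.1‖ := norm_pos_iff.2 x.2
    simp only [hB, Set.mem_preimage, Set.mem_ofPred_eq, homeomorphUnitSphereProd_apply_snd_coe,
      homeomorphUnitSphereProd_apply_fst_coe]
    rw [← hNs _ hx, smul_smul, mul_inv_cancel₀ hx.ne', one_smul]
  have h2 := hmp.measure_preimage hBm.nullMeasurableSet
  rw [h1, comap_subtype_coe_apply (measurableSet_singleton _).compl,
    Subtype.image_preimage_coe, Set.inter_comm, ← Set.sdiff_eq,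
    measure_sdiff_null (measure_singleton _), Measure.prod_apply hBm] at h2
  rw [h2]
  refine lintegral_congr fun x => ?_
  have hx : 0 < N x := hN _ (ne_of_apply_ne Norm.norm (by simp))
  have : Prod.mk x ⁻¹' B = Set.Iio (⟨(N x)⁻¹, inv_pos.2 hx⟩ : Set.Ioi (0 : ℝ)) := by
    ext r
    change r.1 * N x < 1 ↔ r.1 < (N x)⁻¹
    rw [← one_div, lt_div_iff₀ hx]
  rw [this, Measure.volumeIoiPow_apply_Iio, Nat.sub_add_cancel hd, Nat.cast_pred hd,
    sub_add_cancel, inv_pow]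

/-- The volume of the open unit ball of a gauge, relative to the Euclidean ball, is bounded below in
terms of the mean of the gauge over the unit sphere. -/
theorem inv_integral_pow_le_volume_ratio [FiniteDimensional ℝ E]
    (μ : Measure (Metric.sphere (0 : E) 1)) [IsProbabilityMeasure μ]
    (hμ : ∀ g : E ≃ₗᵢ[ℝ] E, MeasurePreserving (sphereRot g) μ μ) (N : E → ℝ)
    (hNc : Continuous N) (hNs : ∀ t : ℝ, 0 < t → ∀ x, N (t • x) = t * N x)
    (hN : ∀ x, x ≠ 0 → 0 < N x) :
    ENNReal.ofReal ((∫ x, N x ∂μ)⁻¹ ^ Module.finrank ℝ E) * volume (Metric.ball (0 : E) 1) ≤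
      volume {x : E | N x < 1} := by
  obtain ⟨x₀⟩ : Nonempty (Metric.sphere (0 : E) 1) := nonempty_of_isProbabilityMeasure μ
  have : Nontrivial E := ⟨⟨x₀, 0, ne_of_apply_ne Norm.norm (by simp)⟩⟩
  have hd : (0 : ℝ) < Module.finrank ℝ E := by exact_mod_cast Module.finrank_pos
  set d := Module.finrank ℝ E with hdd
  have hNS : ∀ x : Metric.sphere (0 : E) 1, 0 < N x :=
    fun x => hN _ (ne_of_apply_ne Norm.norm (by simp))
  have hNSc : Continuous fun x : Metric.sphere (0 : E) 1 => N x := by fun_prop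
  obtain ⟨z, -, hz⟩ := isCompact_univ.exists_isMinOn ⟨x₀, Set.mem_univ _⟩ hNSc.continuousOn
  have hint : ∀ f : Metric.sphere (0 : E) 1 → ℝ, Continuous f → Integrable f μ := fun f hf =>
    hf.integrable_of_hasCompactSupport (HasCompactSupport.of_compactSpace f)
  have hpc : Continuous fun x : Metric.sphere (0 : E) 1 => (N x ^ d)⁻¹ :=
    (hNSc.pow d).inv₀ fun x => (pow_pos (hNS x) d).ne'
  have hjen : ((∫ x, N x ∂μ)⁻¹ ^ d) ≤ ∫ x, (N x ^ d)⁻¹ ∂μ := by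
    have hsub : Set.Ici (N z) ⊆ Set.Ioi 0 := fun t ht => (hNS z).trans_le ht
    have hconv : ConvexOn ℝ (Set.Ici (N z)) fun t : ℝ => (t ^ d)⁻¹ := by
      simpa using (convexOn_zpow (𝕜 := ℝ) (-d : ℤ)).subset hsub (convex_Ici _)
    have := hconv.map_integral_le (μ := μ) (f := fun x : Metric.sphere (0 : E) 1 => N x)
      ((continuousOn_id.pow d).inv₀ fun t ht => (pow_pos (hsub ht) d).ne') isClosed_Ici
      (Filter.Eventually.of_forall fun x => hz (Set.mem_univ x)) (hint _ hNSc) (hint _ hpc)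
    simpa using this
  rw [volume_lt_one_eq_lintegral_toSphere N hNc hNs hN, toSphere_eq_smul μ hμ,
    lintegral_smul_measure, ← ofReal_integral_eq_lintegral_ofReal (hint _ (hpc.div_const _))
      (Filter.Eventually.of_forall fun x =>
        div_nonneg (inv_nonneg.2 (pow_pos (hNS x) d).le) hd.le),
    integral_div, ENNReal.ofReal_div_of_pos hd, ENNReal.ofReal_natCast, smul_eq_mul, ← hdd]
  have hd0 : (d : ENNReal) ≠ 0 := by exact_mod_cast hd.ne'
  calc _ ≤ ENNReal.ofReal (∫ x, (N x ^ d)⁻¹ ∂μ) * volume (Metric.ball (0 : E) 1) := by gcongr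
    _ = (d / d) * (ENNReal.ofReal (∫ x, (N x ^ d)⁻¹ ∂μ) * volume (Metric.ball (0 : E) 1)) := by
      rw [ENNReal.div_self hd0 (ENNReal.natCast_ne_top d), one_mul]
    _ = _ := by
      simp only [div_eq_mul_inv]
      ring

end Sphere

theorem continuous_sphereEval {n : ℕ} (f : MvPolynomial (Fin n) ℝ) : Continuous (sphereEval f) :=
  (MvPolynomial.continuous_eval f).comp (by fun_prop)

/-- The restriction of polynomials to the unit sphere, as a linear map to continuous functions. -/
noncomputable def sphereRestrict (n : ℕ) : MvPolynomial (Fin n) ℝ →ₗ[ℝ]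
    C(Metric.sphere (0 : EuclideanSpace ℝ (Fin n)) 1, ℝ) where
  toFun f := ⟨sphereEval f, continuous_sphereEval f⟩
  map_add' f g := by ext x; simp [sphereEval]
  map_smul' c f := by ext x; simp [sphereEval]

/-- If the `L²` norm of mean-zero continuous functions is controlled by the parameter, then the
functions bounded below by `-1` form a bounded set of parameters. -/
theorem isBounded_neg_one_le {X E : Type*} [TopologicalSpace X] [CompactSpace X]
    [MeasurableSpace X] [BorelSpace X] [NormedAddCommGroup E] [NormedSpace ℝ E]
    (σ : Measure X) [IsProbabilityMeasure σ] (L : E →L[ℝ] C(X, ℝ))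
    (hmean : ∀ a, ∫ x, L a x ∂σ = 0) (hsq : ∀ a, ‖a‖ ^ 2 = ∫ x, L a x * L a x ∂σ) :
    Bornology.IsBounded {a : E | ∀ x, -1 ≤ L a x} := by
  refine isBounded_iff_forall_norm_le.2 ⟨2 * ‖L‖, fun a ha => ?_⟩
  have hint : ∀ f : X → ℝ, Continuous f → Integrable f σ := fun f hf =>
    hf.integrable_of_hasCompactSupport (HasCompactSupport.of_compactSpace f)
  have hc : Continuous (L a) := (L a).continuous
  have hle : ∫ x, L a x * L a x ∂σ ≤ ∫ x, ‖L‖ * ‖a‖ * (L a x + 2) ∂σ := by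
    refine integral_mono (hint _ (by fun_prop)) (hint _ (by fun_prop)) fun x => ?_
    have h1 : |L a x| ≤ ‖L‖ * ‖a‖ := ((L a).norm_coe_le_norm x).trans (L.le_opNorm a)
    have h2 : |L a x| ≤ L a x + 2 := abs_le.2 ⟨by linarith [ha x], by linarith⟩
    calc L a x * L a x = |L a x| * |L a x| := (abs_mul_abs_self _).symm
      _ ≤ _ := by gcongr
  rw [integral_const_mul, integral_add (hint _ hc) (integrable_const _), hmean, ← hsq] at hle
  simp only [integral_const, probReal_univ, one_smul, zero_add] at hle
  rcases (norm_nonneg a).eq_or_lt with h | h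
  · rw [← h]; positivity
  · exact le_of_mul_le_mul_right (by linarith) h

/-- Let `d = binom(n+2k-1, 2k) - 1 = dim U_{2k,n}`, where `U_{2k,n}` is the
space of homogeneous `n`-variate polynomials of degree `2k` with zero mean on the unit sphere
`S^{n-1}`, endowed with the `L²(S^{n-1})` inner product; we parametrize `U_{2k,n}` by a linear
isometry `φ` from `EuclideanSpace ℝ (Fin d)`.  Let `K` be the unit ball, let
`Pos' = {p : p(x) ≥ -1 on S^{n-1}}`, let `Σ` be the unit sphere of `U_{2k,n}` with its
rotation-invariant probability measure `μ`, and `‖p‖_∞ = max_{x ∈ S^{n-1}} |p(x)|`.  Then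
`(vol Pos' / vol K)^{1/d} ≥ (∫_Σ ‖p‖_∞ dμ)⁻¹`. -/
theorem volume_ratio_nonnegative_polynomials_ge {n k : ℕ} (hk : 0 < k)
    (d : ℕ) (hd : d = ((n + 2 * k - 1).choose (2 * k)) - 1)
    -- the rotation-invariant probability measure on the unit sphere `S^{n-1} ⊂ ℝⁿ`
    (σ : Measure (Metric.sphere (0 : EuclideanSpace ℝ (Fin n)) 1)) [IsProbabilityMeasure σ]
    (hσ : ∀ g : EuclideanSpace ℝ (Fin n) ≃ₗᵢ[ℝ] EuclideanSpace ℝ (Fin n),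
      MeasurePreserving (sphereRot g) σ σ)
    -- a linear parametrization of `U_{2k,n}`, isometric for the `L²(S^{n-1})` inner product
    (φ : EuclideanSpace ℝ (Fin d) →ₗ[ℝ] MvPolynomial (Fin n) ℝ)
    (hφinj : Function.Injective φ)
    (hφhom : ∀ a, (φ a).IsHomogeneous (2 * k))
    (hφmean : ∀ a, ∫ x, sphereEval (φ a) x ∂σ = 0)
    (hφsurj : ∀ f : MvPolynomial (Fin n) ℝ, f.IsHomogeneous (2 * k) →
      (∫ x, sphereEval f x ∂σ) = 0 → f ∈ Set.range φ)
    (hφiso : ∀ a b, ⟪a, b⟫ = ∫ x, sphereEval (φ a) x * sphereEval (φ b) x ∂σ)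
    -- the rotation-invariant probability measure on the unit sphere `Σ` of `U_{2k,n}`
    (μ : Measure (Metric.sphere (0 : EuclideanSpace ℝ (Fin d)) 1)) [IsProbabilityMeasure μ]
    (hμ : ∀ g : EuclideanSpace ℝ (Fin d) ≃ₗᵢ[ℝ] EuclideanSpace ℝ (Fin d),
      MeasurePreserving (sphereRot g) μ μ) :
    ((MeasureTheory.volume {a : EuclideanSpace ℝ (Fin d) |
          ∀ x : Metric.sphere (0 : EuclideanSpace ℝ (Fin n)) 1,
            -1 ≤ sphereEval (φ a) x}).toReal /
        (MeasureTheory.volume (Metric.closedBall (0 : EuclideanSpace ℝ (Fin d)) 1)).toReal) ^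
        ((1 : ℝ) / d) ≥
      (∫ p, (⨆ x : Metric.sphere (0 : EuclideanSpace ℝ (Fin n)) 1,
        |sphereEval (φ (p : EuclideanSpace ℝ (Fin d))) x|) ∂μ)⁻¹ := by
  have : Nonempty (Metric.sphere (0 : EuclideanSpace ℝ (Fin d)) 1) :=
    nonempty_of_isProbabilityMeasure μ
  have : Nontrivial (EuclideanSpace ℝ (Fin d)) :=
    let ⟨x⟩ := this
    ⟨⟨x, 0, ne_of_apply_ne Norm.norm (by simp)⟩⟩
  have hd0 : d ≠ 0 := by
    simpa using (Module.finrank_pos (R := ℝ) (M := EuclideanSpace ℝ (Fin d))).ne'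
  set L : EuclideanSpace ℝ (Fin d) →L[ℝ] C(Metric.sphere (0 : EuclideanSpace ℝ (Fin n)) 1, ℝ) :=
    LinearMap.toContinuousLinearMap (sphereRestrict n ∘ₗ φ) with hL
  have hLφ : ∀ a x, sphereEval (φ a) x = L a x := fun a x => rfl
  simp only [hLφ, ← Real.norm_eq_abs, ← ContinuousMap.norm_eq_iSup_norm] at hφmean hφiso ⊢
  have hsq : ∀ a, ‖a‖ ^ 2 = ∫ x, L a x * L a x ∂σ := fun a => by
    rw [← hφiso, real_inner_self_eq_norm_sq]
  have hpos : ∀ a, a ≠ 0 → 0 < ‖L a‖ := fun a ha => by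
    refine norm_pos_iff.2 fun h => ha ?_
    simpa [h] using hsq a
  have hkey := inv_integral_pow_le_volume_ratio μ hμ (fun a => ‖L a‖) (by fun_prop)
    (fun t ht a => by rw [map_smul, norm_smul, Real.norm_of_nonneg ht.le]) hpos
  have hsub : {a | ‖L a‖ < 1} ⊆ {a | ∀ x, -1 ≤ L a x} := fun a ha x =>
    (abs_le.1 (((L a).norm_coe_le_norm x).trans (le_of_lt ha))).1
  have hfin := (isBounded_neg_one_le σ L hφmean hsq).measure_lt_top (μ := volume)
  have hI : 0 ≤ ∫ p : Metric.sphere (0 : EuclideanSpace ℝ (Fin d)) 1, ‖L p‖ ∂μ :=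
    integral_nonneg fun _ => norm_nonneg _
  have hreal := ENNReal.toReal_mono hfin.ne (hkey.trans (measure_mono hsub))
  rw [finrank_euclideanSpace_fin, ENNReal.toReal_mul, ENNReal.toReal_ofReal (by positivity)]
    at hreal
  rw [Measure.addHaar_closedBall_eq_addHaar_ball]
  have hball : 0 < (volume (Metric.ball (0 : EuclideanSpace ℝ (Fin d)) 1)).toReal :=
    ENNReal.toReal_pos (Metric.measure_ball_pos _ _ one_pos).ne' measure_ball_lt_top.ne
  calc _ = (((∫ p : Metric.sphere (0 : EuclideanSpace ℝ (Fin d)) 1, ‖L p‖ ∂μ)⁻¹) ^ d) ^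
        ((1 : ℝ) / d) := by
        rw [one_div, Real.pow_rpow_inv_natCast (inv_nonneg.2 hI) hd0]
    _ ≤ _ := by
        refine Real.rpow_le_rpow (by positivity) ?_ (by positivity)
        rwa [le_div_iff₀ hball]
end
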